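/- arXiv:1206.1381 — 2 statements merged into one kernel-verified Lean document; each statement's English description precedes it below -/
import Mathlib

section
/- Let m ≥ 3 and x ∈ ℝ with f^{(i)}(x) = 2 for some integer 0 ≤ i ≤ m−3; then q_m(x) = 0. On the other hand, if m ≥ 2 and x ∈ ℝ satisfies f^{(m−2)}(x) = 2, then q_m(x) ≠ 0. -/
open Function

noncomputable section

/-- The polynomial map `f(x) = x(5-x)`. -/
def f (x : ℝ) : ℝ := x * (5 - x)

/-- `l(x) = x - 6`. -/
def lf (x : ℝ) : ℝ := x - 6

/-- `s(x) = (2-x)(4-x)(5-x) - (14-3x)`. -/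
def sf (x : ℝ) : ℝ := (2 - x) * (4 - x) * (5 - x) - (14 - 3 * x)

/-- `r(x) = -2(2-x)(5-x)`. -/
def rf (x : ℝ) : ℝ := -2 * (2 - x) * (5 - x)

/-- The decreasing inverse branch of `f`. -/
def phim (x : ℝ) : ℝ := (5 - Real.sqrt (25 - 4 * x)) / 2

/-- The increasing inverse branch of `f`. -/
def phip (x : ℝ) : ℝ := (5 + Real.sqrt (25 - 4 * x)) / 2

/-- `q m` is the function `q_m` from the paper, meaningful for `m ≥ 2`
(the values at `m = 0, 1` are junk values `1`, never used in the statements). -/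
def q : ℕ → ℝ → ℝ
  | 0, _ => 1
  | 1, _ => 1
  | 2, x => sf x
  | 3, x => sf (f x) * sf x - rf (f x) * lf x
  | m + 4, x =>
      sf (f^[m + 2] x) * q (m + 3) x - rf (f^[m + 2] x) * lf (f^[m + 1] x) * q (m + 2) x

open Polynomial IntermediateField

lemma q_add_three (k : ℕ) (x : ℝ) :
    q (k + 3) x = sf (f^[k + 1] x) * q (k + 2) x
      - rf (f^[k + 1] x) * lf (f^[k] x) * q (k + 1) x := by
  cases k <;> simp [q]

/-- At an index where the orbit hits `2`, the recursion degenerates. -/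
lemma q_eq_of_iterate_eq_two {i : ℕ} {x : ℝ} (h : f^[i] x = 2) :
    q (i + 2) x = -8 * q (i + 1) x := by
  cases i with
  | zero =>
    obtain rfl : x = 2 := h
    norm_num [q, sf]
  | succ i =>
    rw [q_add_three, h]
    norm_num [sf, rf]

lemma q_eq_zero_of_iterate_eq_two {i : ℕ} {x : ℝ} (h : f^[i] x = 2) (j : ℕ) :
    q (i + j + 3) x = 0 := by
  have h6 : f^[i + 1] x = 6 := by
    rw [iterate_succ_apply', h]; norm_num [f]
  have h0 : q (i + 3) x = 0 := by
    rw [q_add_three, q_eq_of_iterate_eq_two h, h6, h]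
    norm_num [sf, rf, lf]
    ring
  suffices q (i + j + 3) x = 0 ∧ q (i + j + 4) x = 0 from this.1
  induction j with
  | zero =>
    refine ⟨h0, ?_⟩
    change q (i + 1 + 3) x = 0
    rw [q_add_three, h6, show i + 1 + 2 = i + 3 by rfl, h0]
    norm_num [lf]
  | succ j ih =>
    refine ⟨by simpa [add_assoc, add_comm, add_left_comm] using ih.2, ?_⟩
    change q (i + j + 2 + 3) x = 0
    rw [q_add_three, show i + j + 2 + 2 = i + j + 4 by rfl,
      show i + j + 2 + 1 = i + j + 3 by rfl, ih.1, ih.2]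
    ring

/-- `X ^ 2 ^ k - a` is irreducible as soon as neither `a` nor `-a` is a square. -/
lemma irreducible_X_pow_two_pow_sub_C {K : Type*} [Field K] {a : K}
    (ha : ∀ b : K, b ^ 2 ≠ a) (hna : ∀ b : K, b ^ 2 ≠ -a) (k : ℕ) :
    Irreducible (X ^ 2 ^ k - C a : K[X]) := by
  induction k with
  | zero => simpa using irreducible_X_sub_C a
  | succ k ih =>
    rw [pow_succ']
    refine X_pow_mul_sub_C_irreducible ih fun E _ _ x hx => ?_
    have hk : (2 ^ k : ℕ) ≠ 0 := by positivity
    have hint : IsIntegral K x := not_not.mp fun h => by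
      have := degree_X_pow_sub_C (Nat.pos_of_ne_zero hk) a
      rw [← hx, minpoly.eq_zero h, degree_zero] at this
      exact WithBot.bot_ne_coe this
    refine X_pow_sub_C_irreducible_of_prime Nat.prime_two fun b hb => ?_
    have hnorm : Algebra.norm K b ^ 2 = (-1) ^ (2 ^ k) * -a := by
      rw [← map_pow, hb, ← adjoin.powerBasis_gen hint,
        Algebra.PowerBasis.norm_gen_eq_coeff_zero_minpoly]
      simp [minpoly_gen, hx, hk.symm]
    rcases k with _ | k
    · exact ha _ (by simpa using hnorm)
    · refine hna (Algebra.norm K b) ?_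
      rw [hnorm, Even.neg_one_pow (by simp [pow_succ']), one_mul]

/-- The monic integer polynomial `-f^{(k+1)}`. -/
def negIter : ℕ → ℤ[X]
  | 0 => X ^ 2 - C 5 * X
  | k + 1 => negIter k ^ 2 + C 5 * negIter k

lemma aeval_negIter (k : ℕ) (x : ℝ) : aeval x (negIter k) = -f^[k + 1] x := by
  induction k with
  | zero => simp [negIter, f, map_ofNat]; ring
  | succ k ih =>
    rw [iterate_succ_apply', negIter]
    simp only [map_add, map_mul, map_pow, ih, f, aeval_C]
    simp
    ring

lemma monic_natDegree_negIter (k : ℕ) :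
    (negIter k).Monic ∧ (negIter k).natDegree = 2 ^ (k + 1) := by
  induction k with
  | zero =>
    have : (negIter 0).natDegree = 2 := by rw [negIter]; compute_degree!
    refine ⟨?_, by simpa using this⟩
    rw [negIter]; monicity!
  | succ k ih =>
    obtain ⟨hm, hd⟩ := ih
    have hlt : (C 5 * negIter k).degree < (negIter k ^ 2).degree := by
      refine degree_lt_degree ((natDegree_C_mul_le _ _).trans_lt ?_)
      rw [hm.natDegree_pow, hd]
      have : 0 < 2 ^ (k + 1) := by positivity
      omega
    refine ⟨(hm.pow 2).add_of_left hlt, ?_⟩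
    rw [negIter, natDegree_add_eq_left_of_degree_lt hlt, hm.natDegree_pow, hd]
    ring

lemma map_negIter (k : ℕ) :
    (negIter k).map (Int.castRingHom (ZMod 5)) = X ^ 2 ^ (k + 1) := by
  have h5 : (5 : (ZMod 5)[X]) = 0 := by
    have : (5 : ZMod 5) = 0 := by decide
    rw [← map_ofNat (C : ZMod 5 →+* (ZMod 5)[X]) 5, this, map_zero]
  induction k with
  | zero => simp [negIter, h5]
  | succ k ih => simp [negIter, ih, h5, pow_succ 2 (k + 1), pow_mul]

lemma monic_negIter_add_two (k : ℕ) : (negIter k + C 2).Monic := by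
  refine (monic_natDegree_negIter k).1.add_of_left (degree_C_le.trans_lt ?_)
  rw [← natDegree_pos_iff_degree_pos, (monic_natDegree_negIter k).2]
  positivity

lemma irreducible_negIter_add_two (k : ℕ) : Irreducible (negIter k + C 2) := by
  have ha : ∀ b : ZMod 5, b ^ 2 ≠ -2 := by decide
  have hna : ∀ b : ZMod 5, b ^ 2 ≠ - -2 := by decide
  have : Fact (Nat.Prime 5) := ⟨by norm_num⟩
  refine (monic_negIter_add_two k).irreducible_of_irreducible_map (Int.castRingHom (ZMod 5)) _ ?_
  have h := irreducible_X_pow_two_pow_sub_C (K := ZMod 5) ha hna (k + 1)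
  simpa [map_negIter, map_ofNat] using h

/-- All solutions of `f^{(k+1)}(x) = 2` share the same minimal polynomial over `ℚ`. -/
lemma minpoly_eq_of_iterate_eq_two {k : ℕ} {x : ℝ} (h : f^[k + 1] x = 2) :
    minpoly ℚ x = (negIter k + C 2).map (algebraMap ℤ ℚ) := by
  have hm := monic_negIter_add_two k
  refine (minpoly.eq_of_irreducible_of_monic
    ((hm.irreducible_iff_irreducible_map_fraction_map).1 (irreducible_negIter_add_two k)) ?_
    (hm.map _)).symm
  rw [aeval_map_algebraMap, map_add, aeval_negIter, h, aeval_C]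
  simp

lemma exists_polynomial_iterate (k : ℕ) : ∃ P : ℚ[X], ∀ x : ℝ, aeval x P = f^[k] x := by
  induction k with
  | zero => exact ⟨X, by simp⟩
  | succ k ih =>
    obtain ⟨P, hP⟩ := ih
    exact ⟨P * (5 - P), fun x => by simp [iterate_succ_apply', f, hP, map_ofNat, -iterate_succ]⟩

lemma exists_polynomial_q (k : ℕ) : ∃ P : ℚ[X], ∀ x : ℝ, aeval x P = q (k + 1) x := by
  suffices (∃ P : ℚ[X], ∀ x : ℝ, aeval x P = q (k + 1) x) ∧
      ∃ P : ℚ[X], ∀ x : ℝ, aeval x P = q (k + 2) x from this.1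
  induction k with
  | zero =>
    exact ⟨⟨1, by simp [q]⟩,
      ⟨(2 - X) * (4 - X) * (5 - X) - (14 - 3 * X), by simp [q, sf, map_ofNat]⟩⟩
  | succ k ih =>
    refine ⟨ih.2, ?_⟩
    obtain ⟨⟨P, hP⟩, ⟨Q, hQ⟩⟩ := ih
    obtain ⟨A, hA⟩ := exists_polynomial_iterate k
    obtain ⟨B, hB⟩ := exists_polynomial_iterate (k + 1)
    refine ⟨((2 - B) * (4 - B) * (5 - B) - (14 - 3 * B)) * Q
      - (-2 * (2 - B) * (5 - B)) * (A - 6) * P, fun x => ?_⟩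
    rw [show k + 1 + 2 = k + 3 by rfl, q_add_three, ← hP, ← hQ, ← hA, ← hB]
    simp [sf, rf, lf, map_ofNat]

/-- Vanishing of `q` does not depend on the chosen solution of `f^{(k+1)}(x) = 2`. -/
lemma q_eq_zero_transfer {k j : ℕ} {x y : ℝ} (hx : f^[k + 1] x = 2) (hy : f^[k + 1] y = 2)
    (h : q (j + 1) x = 0) : q (j + 1) y = 0 := by
  obtain ⟨P, hP⟩ := exists_polynomial_q j
  rw [← hP] at h ⊢
  have hd := minpoly.dvd ℚ x h
  rw [minpoly_eq_of_iterate_eq_two hx, ← minpoly_eq_of_iterate_eq_two hy] at hd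
  exact aeval_eq_zero_of_dvd_aeval_eq_zero hd (minpoly.aeval ℚ y)

lemma f_phim {c : ℝ} (hc : c ≤ 25 / 4) : f (phim c) = c := by
  have := Real.sq_sqrt (show 0 ≤ 25 - 4 * c by linarith)
  simp only [f, phim]
  linarith

lemma phim_nonneg {c : ℝ} (hc : 0 ≤ c) : 0 ≤ phim c := by
  have : √(25 - 4 * c) ≤ 5 := Real.sqrt_le_iff.2 ⟨by norm_num, by linarith⟩
  simp only [phim]
  linarith

lemma phim_le {c b : ℝ} (hc : c ≤ b * (5 - b)) : phim c ≤ b := by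
  have : 5 - 2 * b ≤ √(25 - 4 * c) := Real.le_sqrt_of_sq_le (by nlinarith)
  simp only [phim]
  linarith

/-- Backward orbits of a point of `[0, 11/25]` staying close to `0`. -/
lemma exists_backward_orbit {c : ℝ} (hc : 0 ≤ c) (hc' : c ≤ 11 / 25) (k : ℕ) :
    ∃ x : ℝ, f^[k] x = c ∧ ∀ i < k, 0 ≤ f^[i] x ∧ f^[i] x ≤ 1 / 10 := by
  induction k with
  | zero => exact ⟨c, rfl, by simp⟩
  | succ k ih =>
    obtain ⟨x, hx, hi⟩ := ih
    have hx0 : 0 ≤ x ∧ x ≤ 11 / 25 := by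
      rcases k with _ | k
      · obtain rfl : x = c := hx
        exact ⟨hc, hc'⟩
      · have := hi 0 (by omega)
        exact ⟨this.1, this.2.trans (by norm_num)⟩
    have hf : f (phim x) = x := f_phim (by linarith)
    refine ⟨phim x, by rw [iterate_succ_apply, hf, hx], fun i hik => ?_⟩
    rcases i with _ | i
    · exact ⟨phim_nonneg hx0.1, phim_le (by linarith)⟩
    · rw [iterate_succ_apply, hf]
      exact hi i (by omega)

lemma q_growth {x : ℝ} (k : ℕ) (h : ∀ i ≤ k, 0 ≤ f^[i] x ∧ f^[i] x ≤ 1 / 10) :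
    0 < q (k + 1) x ∧ 10 * q (k + 1) x ≤ q (k + 2) x := by
  have hs : ∀ y : ℝ, 0 ≤ y → y ≤ 1 / 10 → 22 ≤ sf y := fun y h0 h1 => by
    simp only [sf]; nlinarith [mul_nonneg h0 (sub_nonneg.2 h1), mul_nonneg h0 (sq_nonneg y)]
  induction k with
  | zero =>
    have h0 := h 0 le_rfl
    have := hs x h0.1 h0.2
    simp only [q]
    constructor <;> linarith
  | succ k ih =>
    obtain ⟨hpos, hle⟩ := ih fun i hi => h i (by omega)
    obtain ⟨ha, ha'⟩ := h k (by omega)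
    obtain ⟨hb, hb'⟩ := h (k + 1) le_rfl
    refine ⟨by change 0 < q (k + 2) x; linarith, ?_⟩
    change 10 * q (k + 2) x ≤ q (k + 3) x
    rw [q_add_three]
    have hsb := hs _ hb hb'
    set a := f^[k] x
    set b := f^[k + 1] x
    have hr : 0 ≤ -rf b ∧ -rf b ≤ 20 := by
      simp only [rf]; constructor <;> nlinarith
    have hl : 0 ≤ -lf a ∧ -lf a ≤ 6 := by
      simp only [lf]; constructor <;> linarith
    have hrl : rf b * lf a ≤ 120 := by
      nlinarith [mul_le_mul hr.2 hl.2 hl.1 (by norm_num : (0 : ℝ) ≤ 20)]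
    nlinarith [mul_le_mul_of_nonneg_right hrl hpos.le,
      mul_le_mul_of_nonneg_right hsb (show 0 ≤ q (k + 2) x by linarith)]

lemma exists_iterate_eq_two_q_pos (k : ℕ) : ∃ x : ℝ, f^[k + 1] x = 2 ∧ 0 < q (k + 2) x := by
  have hc0 : 2 / 5 ≤ phim 2 := by
    have : √(25 - 4 * 2) ≤ 21 / 5 := Real.sqrt_le_iff.2 ⟨by norm_num, by norm_num⟩
    simp only [phim]
    linarith
  have hc1 : phim 2 ≤ 11 / 25 := phim_le (by norm_num)
  obtain ⟨x, hx, hi⟩ := exists_backward_orbit (by linarith) hc1 k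
  refine ⟨x, by rw [iterate_succ_apply', hx, f_phim (by norm_num)], ?_⟩
  have hs : 12 ≤ sf (phim 2) := by
    simp only [sf]
    nlinarith [mul_nonneg (sub_nonneg.2 hc0) (sub_nonneg.2 hc1)]
  rcases k with _ | k
  · obtain rfl : x = phim 2 := hx
    simp only [q]
    linarith
  · obtain ⟨hpos, hle⟩ := q_growth k fun i hik => hi i (by omega)
    obtain ⟨ha, ha'⟩ := hi k (by omega)
    change 0 < q (k + 3) x
    rw [q_add_three, hx]
    have hr : 0 ≤ -rf (phim 2) ∧ -rf (phim 2) ≤ 15 := by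
      simp only [rf]; constructor <;> nlinarith
    have hl : 0 ≤ -lf (f^[k] x) ∧ -lf (f^[k] x) ≤ 6 := by
      simp only [lf]; constructor <;> linarith
    have hrl : rf (phim 2) * lf (f^[k] x) ≤ 90 := by
      nlinarith [mul_le_mul hr.2 hl.2 hl.1 (by norm_num : (0 : ℝ) ≤ 15)]
    nlinarith [mul_le_mul_of_nonneg_right hrl hpos.le,
      mul_le_mul_of_nonneg_right hs (show 0 ≤ q (k + 2) x by linarith)]

theorem statement_3 :
    (∀ m : ℕ, 3 ≤ m → ∀ x : ℝ, ∀ i : ℕ, i ≤ m - 3 → f^[i] x = 2 → q m x = 0) ∧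
    (∀ m : ℕ, 2 ≤ m → ∀ x : ℝ, f^[m - 2] x = 2 → q m x ≠ 0) := by
  refine ⟨fun m hm x i hi h => ?_, fun m hm x h => ?_⟩
  · obtain ⟨j, rfl⟩ : ∃ j, m = i + j + 3 := ⟨m - 3 - i, by omega⟩
    exact q_eq_zero_of_iterate_eq_two h j
  · obtain ⟨n, rfl⟩ : ∃ n, m = n + 2 := ⟨m - 2, by omega⟩
    rw [Nat.add_sub_cancel] at h
    rw [q_eq_of_iterate_eq_two h]
    refine mul_ne_zero (by norm_num) fun h0 => ?_
    rcases n with _ | k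
    · simp [q] at h0
    · obtain ⟨y, hy, hpos⟩ := exists_iterate_eq_two_q_pos k
      exact hpos.ne' (q_eq_zero_transfer h hy h0)
end
end

section
/- For every integer m ≥ 1 one has q_mᴺ(0) = 0 and q_mᴺ(6) = 0. Moreover, for every m ≥ 2 and x ∈ ℝ, if f^{(i)}(x) ∈ {2, 5} for some integer 0 ≤ i ≤ m−2, then q_mᴺ(x) = 0. -/
open Function

noncomputable section

/-- `ltN m` is the auxiliary function `l̃_m` from the paper, meaningful for `m ≥ 1`
(the value at `m = 0` is a junk value `1`). -/
def ltN : ℕ → ℝ → ℝ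
  | 0, _ => 1
  | 1, x => 4 - x
  | 2, x => (4 - f x) * sf x + 4 * lf x
  | m + 3, x => sf x * ltN (m + 2) (f x) - rf (f x) * lf x * ltN (m + 1) (f (f x))

/-- `qN m` is the function `q_mᴺ` from the paper, meaningful for `m ≥ 1`. -/
def qN (m : ℕ) (x : ℝ) : ℝ :=
  if m = 1 then x ^ 2 - 6 * x
  else (2 - x) * ltN m x - 4 * (2 - x) * (5 - x) * ltN (m - 1) (f x)

theorem ltN_zero (n : ℕ) : ltN (n + 1) 0 = 4 * 20 ^ n := by
  induction n using Nat.twoStepInduction with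
  | zero => simp [ltN]
  | one => norm_num [ltN, f, sf, lf]
  | more n ih₁ ih₂ =>
    have hf : f 0 = 0 := by simp [f]
    rw [ltN, hf, hf, ih₁, ih₂]
    norm_num [sf, lf, rf]
    ring

theorem ltN_six (n : ℕ) : ltN (n + 2) 6 = -4 * ltN (n + 1) (-6) := by
  have hf : f 6 = -6 := by norm_num [f]
  cases n with
  | zero => norm_num [ltN, hf, sf, lf]
  | succ n =>
    rw [ltN, hf]
    norm_num [sf, lf]

theorem ltN_two (n : ℕ) : ltN (n + 2) 2 = 0 := by
  have hf : f 2 = 6 := by norm_num [f]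
  have hf' : f 6 = -6 := by norm_num [f]
  cases n with
  | zero => norm_num [ltN, hf, sf, lf]
  | succ n =>
    rw [ltN, hf, hf', ltN_six]
    norm_num [sf, lf, rf]
    ring

theorem ltN_five (n : ℕ) : ltN (n + 2) 5 = 0 := by
  have hf : f 5 = 0 := by norm_num [f]
  have hf' : f 0 = 0 := by norm_num [f]
  cases n with
  | zero => norm_num [ltN, hf, sf, lf]
  | succ n =>
    rw [ltN, hf, hf', ltN_zero, ltN_zero]
    norm_num [sf, lf, rf]
    ring

/-- `l̃_m` vanishes at every point whose orbit under `f` meets `{2, 5}` within `m - 2` steps. -/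
theorem ltN_eq_zero_of_iterate (i n : ℕ) (x : ℝ) (h : f^[i] x = 2 ∨ f^[i] x = 5) :
    ltN (n + i + 2) x = 0 := by
  induction i using Nat.twoStepInduction generalizing x with
  | zero =>
    rcases h with rfl | rfl
    · exact ltN_two n
    · exact ltN_five n
  | one =>
    rw [iterate_one] at h
    rcases h with h | h
    · rw [ltN, h, ltN_two]
      simp [rf]
    · rw [ltN, h, ltN_five]
      simp [rf]
  | more i ih₁ ih₂ =>
    have h₂ : ltN (n + (i + 1) + 2) (f x) = 0 := ih₂ (f x) h
    have h₁ : ltN (n + i + 2) (f (f x)) = 0 := ih₁ (f (f x)) h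
    change sf x * ltN (n + (i + 1) + 2) (f x)
      - rf (f x) * lf x * ltN (n + i + 2) (f (f x)) = 0
    rw [h₁, h₂]
    ring

theorem qN_add_two (n : ℕ) (x : ℝ) :
    qN (n + 2) x = (2 - x) * ltN (n + 2) x - 4 * (2 - x) * (5 - x) * ltN (n + 1) (f x) := by
  simp [qN]

theorem statement_17 :
    (∀ m : ℕ, 1 ≤ m → qN m 0 = 0 ∧ qN m 6 = 0) ∧
    (∀ m : ℕ, 2 ≤ m → ∀ x : ℝ, ∀ i : ℕ, i ≤ m - 2 →
      (f^[i] x = 2 ∨ f^[i] x = 5) → qN m x = 0) := by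
  refine ⟨fun m hm => ?_, fun m hm x i hi h => ?_⟩
  · obtain rfl | ⟨n, rfl⟩ : m = 1 ∨ ∃ n, m = n + 2 := by
      rcases hm.eq_or_lt with h | h
      · exact Or.inl h.symm
      · exact Or.inr ⟨m - 2, by omega⟩
    · norm_num [qN]
    · have hf : f 0 = 0 := by simp [f]
      have hf' : f 6 = -6 := by norm_num [f]
      rw [qN_add_two, qN_add_two, hf, hf', ltN_zero, ltN_zero, ltN_six]
      constructor <;> ring
  · obtain ⟨n, rfl⟩ : ∃ n, m = n + i + 2 := ⟨m - 2 - i, by omega⟩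
    rw [qN_add_two, ltN_eq_zero_of_iterate i n x h]
    cases i with
    | zero => rcases h with rfl | rfl <;> simp
    | succ i =>
      have h' : ltN (n + (i + 1) + 1) (f x) = 0 := ltN_eq_zero_of_iterate i n (f x) h
      rw [h']
      ring
end
end
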